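/- Higher-order interpolation estimate (estimate (5.10), part of Lemma 5.6 of the paper, in conditional form): Let α ∈ (0,1), let k ≥ 10 be an integer, and let C₀ > 0. Suppose v : ℝ^d × ℝ → ℝ is smooth and for every t ≥ 1 satisfies (i) sup_{Q_ρ(t)} |v| ≤ C₀ e^{−2t}, (ii) [𝔇⁸v]_{α,Q_ρ(t)} ≤ C₀ e^{−t}, and (iii) [𝔇^ℓ v]_{α,Q_ρ(t)} ≤ C₀ e^{(ℓ−10)t/2} for every integer 8 ≤ ℓ ≤ 2k+10. Then there exists C > 0 such that for every t ≥ 1: sup_{Q_{ρ′}(t)} |𝔇^ℓ v| ≤ C e^{−(t/2)(4 − 2ℓ/(8+α))} for every integer 0 ≤ ℓ ≤ 8, and sup_{Q_{ρ′}(t)} |𝔇^ℓ v| ≤ C e^{−(t/2)(4 − ℓ(ℓ−6)/(ℓ+α))} for every integer 8 ≤ ℓ ≤ 2k+10. -/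

import Mathlib

open Real Finset

/-- The `p`-th spatial Fréchet derivative of the `q`-th time derivative of
`u : ℝ^d × ℝ → ℝ` (space is the first variable, time the second). -/
noncomputable def spaceTimeDeriv (d : ℕ) (u : EuclideanSpace ℝ (Fin d) × ℝ → ℝ)
    (p q : ℕ) (x : EuclideanSpace ℝ (Fin d)) (s : ℝ) :
    ContinuousMultilinearMap ℝ (fun _ : Fin p => EuclideanSpace ℝ (Fin d)) ℝ :=
  iteratedFDeriv ℝ p (fun y => iteratedDeriv q (fun τ => u (y, τ)) s) x

/-- `|𝔇^k u (z)| = sqrt (Σ_{p+2q=k} ‖D_x^p ∂_t^q u(z)‖²)`. -/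
noncomputable def frakDNorm (d : ℕ) (u : EuclideanSpace ℝ (Fin d) × ℝ → ℝ)
    (k : ℕ) (z : EuclideanSpace ℝ (Fin d) × ℝ) : ℝ :=
  Real.sqrt (∑ q ∈ Finset.range (k / 2 + 1), ‖spaceTimeDeriv d u (k - 2 * q) q z.1 z.2‖ ^ 2)

/-- The parabolic cylinder `Q_ρ(t) = {(x,s) : |x| ≤ ρ, t-1 ≤ s ≤ t}`. -/
def parabolicCylinder (d : ℕ) (ρ t : ℝ) : Set (EuclideanSpace ℝ (Fin d) × ℝ) :=
  {z | ‖z.1‖ ≤ ρ ∧ t - 1 ≤ z.2 ∧ z.2 ≤ t}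

/-- The parabolic distance `|x-x'| + |s-s'|^{1/2}`. -/
noncomputable def parabolicDist (d : ℕ) (z w : EuclideanSpace ℝ (Fin d) × ℝ) : ℝ :=
  ‖z.1 - w.1‖ + |z.2 - w.2| ^ ((1 : ℝ) / 2)

/-- `[𝔇^k u]_{α,Q} ≤ B`: the sum over the components `D_x^{k-2q} ∂_t^q u` of their
parabolic `α`-Hölder seminorms over `Q` is at most `B`. -/
def frakDHolderLE (d : ℕ) (u : EuclideanSpace ℝ (Fin d) × ℝ → ℝ) (k : ℕ) (α : ℝ)
    (Q : Set (EuclideanSpace ℝ (Fin d) × ℝ)) (B : ℝ) : Prop :=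
  ∃ M : ℕ → ℝ, (∀ q, 0 ≤ M q) ∧ (∑ q ∈ Finset.range (k / 2 + 1), M q) ≤ B ∧
    ∀ q ∈ Finset.range (k / 2 + 1), ∀ z ∈ Q, ∀ w ∈ Q,
      ‖spaceTimeDeriv d u (k - 2 * q) q z.1 z.2 - spaceTimeDeriv d u (k - 2 * q) q w.1 w.2‖
        ≤ M q * parabolicDist d z w ^ α

section Helpers

open Set in
/-- Taylor remainder bound for a chain of derivatives. -/
lemma taylor_chain {F : Type*} [NormedAddCommGroup F] [NormedSpace ℝ F] (N : ℕ) :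
    ∀ (f : ℕ → ℝ → F) (_ : ∀ i a, HasDerivAt (f i) (f (i + 1) a) a) (H : ℝ)
      (_ : ∀ a ∈ Icc (0 : ℝ) 1, ‖f N a - f N 0‖ ≤ H),
      ∀ a ∈ Icc (0 : ℝ) 1,
        ‖f 0 a - ∑ i ∈ Finset.range (N + 1), (a ^ i / (i.factorial : ℝ)) • f i 0‖ ≤ H := by
  induction N with
  | zero =>
    intro f hf H hH a ha
    simpa using hH a ha
  | succ N ih =>
    intro f hf H hH a ha
    have h0 : 0 ≤ H := le_trans (norm_nonneg _) (hH a ha)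
    have ih' := ih (fun i => f (i + 1)) (fun i a => hf (i + 1) a) H hH
    have hd : ∀ b, HasDerivAt
        (fun b => f 0 b - ∑ i ∈ Finset.range (N + 2), (b ^ i / (i.factorial : ℝ)) • f i 0)
        (f 1 b - ∑ i ∈ Finset.range (N + 1), (b ^ i / (i.factorial : ℝ)) • f (i + 1) 0) b := by
      intro b
      refine (hf 0 b).sub ?_
      have e : ∀ b : ℝ, ∑ i ∈ Finset.range (N + 2), (b ^ i / (i.factorial : ℝ)) • f i 0
          = ∑ i ∈ Finset.range (N + 1), (b ^ (i + 1) / ((i + 1).factorial : ℝ)) • f (i + 1) 0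
            + f 0 0 := by
        intro b
        rw [Finset.sum_range_succ']
        simp
      simp_rw [e]
      refine HasDerivAt.add_const _ ?_
      refine HasDerivAt.fun_sum fun i _ => ?_
      refine HasDerivAt.smul_const ?_ _
      have := (hasDerivAt_pow (i + 1) b).div_const ((i + 1).factorial : ℝ)
      convert this using 1
      rw [Nat.factorial_succ]
      push_cast
      have : (i.factorial : ℝ) ≠ 0 := by positivity
      have : (i : ℝ) + 1 ≠ 0 := by positivity
      field_simp
    have := (convex_Icc (0 : ℝ) 1).norm_image_sub_le_of_norm_hasDerivWithin_le
      (fun b _ => (hd b).hasDerivWithinAt) (fun b hb => ih' b hb)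
      (left_mem_Icc.2 zero_le_one) ha
    have e0 : f 0 0 - ∑ i ∈ Finset.range (N + 2), ((0 : ℝ) ^ i / (i.factorial : ℝ)) • f i 0 = 0 := by
      rw [Finset.sum_range_succ']
      simp
    rw [e0, sub_zero] at this
    refine this.trans ?_
    have : ‖a - 0‖ ≤ 1 := by
      rw [sub_zero, Real.norm_eq_abs, abs_of_nonneg ha.1]; exact ha.2
    nlinarith

/-- Weights extracting the linear coefficient. -/
lemma exists_weights (N : ℕ) (hN : 1 ≤ N) : ∃ w : ℕ → ℝ, ∀ i ∈ Finset.range (N + 1),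
    ∑ k ∈ Finset.range (N + 1), w k * ((k : ℝ) / N) ^ i = if i = 1 then 1 else 0 := by
  classical
  refine ⟨fun k => (Lagrange.basis (Finset.range (N + 1)) (fun k : ℕ => (k : ℝ) / N) k).coeff 1, ?_⟩
  intro i hi
  have hN' : (N : ℝ) ≠ 0 := by positivity
  have hinj : Set.InjOn (fun k : ℕ => (k : ℝ) / N) (Finset.range (N + 1)) := by
    intro a _ b _ hab
    have : (a : ℝ) / N = (b : ℝ) / N := hab
    field_simp at this
    exact_mod_cast this
  have := Lagrange.eq_interpolate (f := (Polynomial.X ^ i : Polynomial ℝ)) hinj (by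
    rw [Polynomial.degree_X_pow, Finset.card_range]
    exact_mod_cast Finset.mem_range.1 hi)
  rw [Lagrange.interpolate_apply] at this
  have h2 := congrArg (fun P => Polynomial.coeff P 1) this
  simp only [Polynomial.finsetSum_coeff, Polynomial.coeff_C_mul, Polynomial.coeff_X_pow,
    Polynomial.eval_pow, Polynomial.eval_X] at h2
  rw [Finset.sum_congr rfl fun k _ => mul_comm _ _, ← h2]
  simp [eq_comm]

open Set in
lemma one_dim (N : ℕ) (hN : 1 ≤ N) : ∃ C : ℝ, 0 ≤ C ∧
    ∀ (F : Type) [NormedAddCommGroup F] [NormedSpace ℝ F]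
      (f : ℕ → ℝ → F) (_ : ∀ i a, HasDerivAt (f i) (f (i + 1) a) a) (A H : ℝ)
      (_ : ∀ a ∈ Icc (0 : ℝ) 1, ‖f 0 a‖ ≤ A)
      (_ : ∀ a ∈ Icc (0 : ℝ) 1, ‖f N a - f N 0‖ ≤ H), ‖f 1 0‖ ≤ C * (A + H) := by
  obtain ⟨w, hw⟩ := exists_weights N hN
  refine ⟨∑ k ∈ Finset.range (N + 1), |w k|, by positivity, ?_⟩
  intro F _ _ f hf A H hA hH
  have hT := taylor_chain N f hf H hH
  have hx : ∀ k ∈ Finset.range (N + 1), (k : ℝ) / N ∈ Icc (0 : ℝ) 1 := by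
    intro k hk
    have hN' : (0 : ℝ) < N := by positivity
    refine ⟨by positivity, ?_⟩
    rw [div_le_one hN']
    exact_mod_cast Nat.lt_succ_iff.1 (Finset.mem_range.1 hk)
  have key : f 1 0 = ∑ k ∈ Finset.range (N + 1), w k •
      (∑ i ∈ Finset.range (N + 1), (((k : ℝ) / N) ^ i / (i.factorial : ℝ)) • f i 0) := by
    simp_rw [Finset.smul_sum]
    rw [Finset.sum_comm]
    have : ∀ i ∈ Finset.range (N + 1), ∑ k ∈ Finset.range (N + 1),
        w k • (((k : ℝ) / N) ^ i / (i.factorial : ℝ)) • f i 0 = if i = 1 then f 1 0 else 0 := by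
      intro i hi
      simp_rw [smul_smul]
      rw [← Finset.sum_smul]
      simp_rw [← mul_div_assoc]
      rw [← Finset.sum_div, hw i hi]
      split_ifs with h
      · subst h; simp
      · simp
    rw [Finset.sum_congr rfl this]
    simp
    intro h
    omega
  rw [key, Finset.sum_mul]
  refine norm_sum_le_of_le _ fun k hk => ?_
  rw [norm_smul, Real.norm_eq_abs]
  refine mul_le_mul_of_nonneg_left ?_ (abs_nonneg _)
  have h1 := hT _ (hx k hk)
  have h2 := hA _ (hx k hk)
  rw [norm_sub_rev] at h1
  have := norm_le_norm_add_norm_sub' (∑ i ∈ Finset.range (N + 1), (((k : ℝ) / N) ^ i / (i.factorial : ℝ)) • f i 0) (f 0 ((k : ℝ) / N))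
  linarith

/-- Interpolation in time. -/
lemma time_interp (n : ℕ) : ∀ q ≤ n, ∃ C : ℝ, 1 ≤ C ∧
    ∀ (F : Type) [NormedAddCommGroup F] [NormedSpace ℝ F]
      (φ : ℕ → ℝ → F) (_ : ∀ i a, HasDerivAt (φ i) (φ (i + 1) a) a) (t h A H : ℝ)
      (_ : 0 < h) (_ : h ≤ 1 / 2) (_ : 0 ≤ A) (_ : 0 ≤ H)
      (_ : ∀ s, t - 1 ≤ s → s ≤ t → ‖φ 0 s‖ ≤ A)
      (_ : ∀ s s', t - 1 ≤ s → s ≤ t → t - 1 ≤ s' → s' ≤ t → |s - s'| ≤ h →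
        ‖φ n s - φ n s'‖ ≤ H),
      ∀ s, t - 1 ≤ s → s ≤ t → ‖φ q s‖ ≤ C * (A + h ^ n * H) / h ^ q := by
  intro q
  induction q with
  | zero =>
    intro _
    refine ⟨1, le_rfl, ?_⟩
    intro F _ _ φ hφ t h A H hh hh2 hA0 hH0 hA hH s hs hs'
    have := hA s hs hs'
    have : 0 ≤ h ^ n * H := by positivity
    simp
    linarith
  | succ q ih =>
    intro hq
    obtain ⟨C, hC, ih⟩ := ih (by omega)
    obtain ⟨D, hD, h1⟩ := one_dim (n - q) (by omega)
    refine ⟨D * (C + 1) + 1, by nlinarith, ?_⟩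
    intro F _ _ φ hφ t h A H hh hh2 hA0 hH0 hA hH s hs hs'
    have ih := ih F φ hφ t h A H hh hh2 hA0 hH0 hA hH
    obtain ⟨e, he, hin⟩ : ∃ e : ℝ, |e| = h ∧ ∀ a ∈ Set.Icc (0 : ℝ) 1,
        t - 1 ≤ s + a * e ∧ s + a * e ≤ t := by
      by_cases hc : s ≤ t - 1 / 2
      · refine ⟨h, abs_of_pos hh, fun a ha => ⟨?_, ?_⟩⟩ <;> nlinarith [ha.1, ha.2]
      · refine ⟨-h, by rw [abs_neg, abs_of_pos hh], fun a ha => ⟨?_, ?_⟩⟩ <;>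
          nlinarith [ha.1, ha.2]
    have hd : ∀ (i : ℕ) (a : ℝ), HasDerivAt (fun a => e ^ i • φ (q + i) (s + a * e))
        (e ^ (i + 1) • φ (q + (i + 1)) (s + a * e)) a := by
      intro i a
      have h2 : HasDerivAt (fun a : ℝ => s + a * e) e a := by
        simpa using ((hasDerivAt_id a).mul_const e).const_add s
      have := ((hφ (q + i) (s + a * e)).scomp a h2).const_smul (e ^ i)
      rw [smul_smul, ← pow_succ] at this
      exact this
    set K := A + h ^ n * H with hK
    have hK0 : 0 ≤ K := by positivity
    have hpw : h ^ (n - q) * H ≤ K / h ^ q := by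
      rw [le_div_iff₀ (by positivity)]
      have : h ^ (n - q) * H * h ^ q = h ^ n * H := by
        rw [mul_right_comm, ← pow_add]; congr 2; omega
      rw [this]; linarith
    have res := h1 F (fun i a => e ^ i • φ (q + i) (s + a * e)) hd (C * K / h ^ q)
      (h ^ (n - q) * H) (fun a ha => by
        simpa using ih _ (hin a ha).1 (hin a ha).2) (fun a ha => by
        have e1 : q + (n - q) = n := by omega
        simp only [e1]
        rw [← smul_sub, norm_smul, norm_pow, Real.norm_eq_abs, he]
        refine mul_le_mul_of_nonneg_left ?_ (by positivity)
        have h0 := hin 0 (by simp)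
        refine hH _ _ (hin a ha).1 (hin a ha).2 h0.1 h0.2 ?_
        have : s + a * e - (s + 0 * e) = a * e := by ring
        rw [this, abs_mul, he, abs_of_nonneg ha.1]
        nlinarith [ha.1, ha.2])
    simp only [pow_one, zero_mul, add_zero] at res
    rw [norm_smul, Real.norm_eq_abs, he] at res
    rw [le_div_iff₀ (by positivity)]
    have hq0 : 0 < h ^ q := by positivity
    have : h * ‖φ (q + 1) s‖ ≤ D * (C + 1) * K / h ^ q := by
      refine res.trans ?_
      have : D * (C * K / h ^ q + h ^ (n - q) * H) ≤ D * (C * K / h ^ q + K / h ^ q) := by gcongr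
      refine this.trans (le_of_eq ?_)
      field_simp
    rw [le_div_iff₀ hq0] at this
    calc ‖φ (q + 1) s‖ * h ^ (q + 1) = h * ‖φ (q + 1) s‖ * h ^ q := by ring
      _ ≤ _ := this
      _ ≤ _ := by nlinarith

section Space

variable {E : Type} [NormedAddCommGroup E] [NormedSpace ℝ E]

/-- Evaluate the first `i` slots at `w`. -/
noncomputable def evT (w : E) (p : ℕ) : ∀ i : ℕ,
    (ContinuousMultilinearMap ℝ (fun _ : Fin (p + i) => E) ℝ) →L[ℝ]
      (ContinuousMultilinearMap ℝ (fun _ : Fin p => E) ℝ)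
  | 0 => ContinuousLinearMap.id ℝ _
  | i + 1 => (evT w p i).comp ((ContinuousLinearMap.apply ℝ _ w).comp
      ((continuousMultilinearCurryLeftEquiv ℝ
        (fun _ : Fin (p + i + 1) => E) ℝ).toContinuousLinearEquiv.toContinuousLinearMap))

lemma evT_norm (w : E) (p i : ℕ) (L : ContinuousMultilinearMap ℝ (fun _ : Fin (p + i) => E) ℝ) :
    ‖evT w p i L‖ ≤ ‖w‖ ^ i * ‖L‖ := by
  induction i with
  | zero => simp [evT]
  | succ i ih =>
    have h : evT w p (i + 1) L = evT w p i
        ((continuousMultilinearCurryLeftEquiv ℝ (fun _ : Fin (p + i + 1) => E) ℝ L) w) := rfl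
    rw [h]
    refine (ih _).trans ?_
    have := (continuousMultilinearCurryLeftEquiv ℝ (fun _ : Fin (p + i + 1) => E) ℝ L).le_opNorm w
    rw [LinearIsometryEquiv.norm_map] at this
    calc _ ≤ ‖w‖ ^ i * (‖L‖ * ‖w‖) := by gcongr
      _ = _ := by rw [pow_succ]; ring

lemma evT_hasDerivAt (g : E → ℝ) (hg : ContDiff ℝ (⊤ : ℕ∞) g) (x w : E) (p i : ℕ) (a : ℝ) :
    HasDerivAt (fun a : ℝ => evT w p i (iteratedFDeriv ℝ (p + i) g (x + a • w)))
      (evT w p (i + 1) (iteratedFDeriv ℝ (p + (i + 1)) g (x + a • w))) a := by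
  have hdiff : Differentiable ℝ (iteratedFDeriv ℝ (p + i) g) :=
    hg.differentiable_iteratedFDeriv (by exact_mod_cast WithTop.coe_lt_top _)
  have h2 : HasDerivAt (fun a : ℝ => x + a • w) w a := by
    simpa using ((hasDerivAt_id a).smul_const w).const_add x
  have h3 := (hdiff (x + a • w)).hasFDerivAt.comp_hasDerivAt a h2
  have h4 := (evT w p i).hasFDerivAt.comp_hasDerivAt a h3
  have h5 : evT w p (i + 1) (iteratedFDeriv ℝ (p + (i + 1)) g (x + a • w))
      = evT w p i (fderiv ℝ (iteratedFDeriv ℝ (p + i) g) (x + a • w) w) := by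
    have e : iteratedFDeriv ℝ (p + (i + 1)) g (x + a • w) =
      (continuousMultilinearCurryLeftEquiv ℝ (fun _ : Fin (p + i + 1) => E) ℝ).symm
        (fderiv ℝ (iteratedFDeriv ℝ (p + i) g) (x + a • w)) :=
      congrFun (iteratedFDeriv_succ_eq_comp_left (f := g) (n := p + i)) _
    have h : ∀ L, evT w p (i + 1) L = evT w p i
        ((continuousMultilinearCurryLeftEquiv ℝ (fun _ : Fin (p + i + 1) => E) ℝ L) w) :=
      fun _ => rfl
    rw [h, e, LinearIsometryEquiv.apply_symm_apply]
  rw [h5]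
  exact h4

end Space

/-- Interpolation in space. -/
lemma space_interp (n : ℕ) : ∀ p ≤ n, ∃ C : ℝ, 1 ≤ C ∧
    ∀ (E : Type) [NormedAddCommGroup E] [NormedSpace ℝ E]
      (g : E → ℝ) (_ : ContDiff ℝ (⊤ : ℕ∞) g) (ρ h A H : ℝ)
      (_ : 0 < h) (_ : 0 ≤ A) (_ : 0 ≤ H)
      (_ : ∀ x, ‖x‖ ≤ ρ → ‖g x‖ ≤ A)
      (_ : ∀ x y, ‖x‖ ≤ ρ → ‖y‖ ≤ ρ → ‖x - y‖ ≤ h →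
        ‖iteratedFDeriv ℝ n g x - iteratedFDeriv ℝ n g y‖ ≤ H),
      ∀ x, ‖x‖ + p * h ≤ ρ → ‖iteratedFDeriv ℝ p g x‖ ≤ C * (A + h ^ n * H) / h ^ p := by
  intro p
  induction p with
  | zero =>
    intro _
    refine ⟨1, le_rfl, ?_⟩
    intro E _ _ g hg ρ h A H hh hA0 hH0 hA hH x hx
    have := hA x (by simpa using hx)
    have : 0 ≤ h ^ n * H := by positivity
    rw [norm_iteratedFDeriv_zero, pow_zero, div_one, one_mul]
    linarith
  | succ p ih =>
    intro hp
    obtain ⟨C, hC, ih⟩ := ih (by omega)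
    obtain ⟨D, hD, h1⟩ := one_dim (n - p) (by omega)
    refine ⟨D * (C + 1) + 1, by nlinarith, ?_⟩
    intro E _ _ g hg ρ h A H hh hA0 hH0 hA hH x hx
    have ih := ih E g hg ρ h A H hh hA0 hH0 hA hH
    set K := A + h ^ n * H with hK
    have hK0 : 0 ≤ K := by positivity
    have hp0 : 0 < h ^ p := by positivity
    have hpw : h ^ (n - p) * H ≤ K / h ^ p := by
      rw [le_div_iff₀ (by positivity)]
      have : h ^ (n - p) * H * h ^ p = h ^ n * H := by
        rw [mul_right_comm, ← pow_add]; congr 2; omega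
      rw [this]; linarith
    have hw : ∀ w : E, ‖w‖ = h → ‖fderiv ℝ (iteratedFDeriv ℝ p g) x w‖ ≤
        D * (C + 1) * K / h ^ p := by
      intro w hw
      have hin : ∀ a ∈ Set.Icc (0 : ℝ) 1, ‖x + a • w‖ ≤ ‖x‖ + h := by
        intro a ha
        refine (norm_add_le _ _).trans ?_
        rw [norm_smul, hw, Real.norm_eq_abs, abs_of_nonneg ha.1]
        nlinarith [ha.2]
      push_cast at hx
      have hph : 0 ≤ (p : ℝ) * h := by positivity
      have res := h1 _ (fun i a => evT w p i (iteratedFDeriv ℝ (p + i) g (x + a • w)))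
        (fun i a => evT_hasDerivAt g hg x w p i a) (C * K / h ^ p) (h ^ (n - p) * H)
        (fun a ha => by
          refine ih (x + a • w) ?_
          have := hin a ha
          linarith) (fun a ha => by
          rw [← map_sub]
          refine (evT_norm _ _ _ _).trans ?_
          rw [hw]
          refine mul_le_mul_of_nonneg_left ?_ (by positivity)
          have e1 : p + (n - p) = n := by omega
          rw [e1]
          have h2 := hin a ha
          have h3 := hin 0 (by simp)
          refine hH _ _ (by linarith) (by linarith) ?_
          have : x + a • w - (x + (0 : ℝ) • w) = a • w := by simp
          rw [this, norm_smul, hw, Real.norm_eq_abs, abs_of_nonneg ha.1]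
          nlinarith [ha.1, ha.2])
      have e2 : evT w p 1 (iteratedFDeriv ℝ (p + 1) g (x + (0 : ℝ) • w))
          = fderiv ℝ (iteratedFDeriv ℝ p g) x w := by
        have e : iteratedFDeriv ℝ (p + 1) g x =
          (continuousMultilinearCurryLeftEquiv ℝ (fun _ : Fin (p + 1) => E) ℝ).symm
            (fderiv ℝ (iteratedFDeriv ℝ p g) x) :=
          congrFun (iteratedFDeriv_succ_eq_comp_left (f := g) (n := p)) _
        have h : ∀ L, evT w p 1 L =
            ((continuousMultilinearCurryLeftEquiv ℝ (fun _ : Fin (p + 1) => E) ℝ L) w) :=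
          fun _ => rfl
        rw [zero_smul, add_zero, h, e, LinearIsometryEquiv.apply_symm_apply]
      simp only [e2] at res
      refine res.trans ?_
      have : D * (C * K / h ^ p + h ^ (n - p) * H) ≤ D * (C * K / h ^ p + K / h ^ p) := by gcongr
      refine this.trans (le_of_eq ?_)
      field_simp
    rw [← norm_fderiv_iteratedFDeriv]
    have hb : 0 ≤ D * (C + 1) * K / h ^ (p + 1) := by positivity
    have : ‖fderiv ℝ (iteratedFDeriv ℝ p g) x‖ ≤ D * (C + 1) * K / h ^ (p + 1) := by
      refine ContinuousLinearMap.opNorm_le_of_unit_norm hb fun w hw1 => ?_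
      have := hw (h • w) (by rw [norm_smul, hw1, Real.norm_eq_abs, abs_of_pos hh, mul_one])
      rw [map_smul, norm_smul, Real.norm_eq_abs, abs_of_pos hh, le_div_iff₀ hp0] at this
      rw [le_div_iff₀ (by positivity)]
      calc _ = h * ‖(fderiv ℝ (iteratedFDeriv ℝ p g) x) w‖ * h ^ p := by ring
        _ ≤ _ := this
    refine this.trans ?_
    gcongr
    linarith

section Joint

variable {E : Type} [NormedAddCommGroup E] [NormedSpace ℝ E]
variable {F : Type} [NormedAddCommGroup F] [NormedSpace ℝ F]

lemma joint_dt (G : E × ℝ → F) (hG : ContDiff ℝ (⊤ : ℕ∞) G) (x : E) (s : ℝ) :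
    HasDerivAt (fun τ => G (x, τ)) (fderiv ℝ G (x, s) (0, 1)) s := by
  have h1 : HasDerivAt (fun τ : ℝ => ((x, τ) : E × ℝ)) (0, 1) s :=
    (hasDerivAt_const s x).prodMk (hasDerivAt_id s)
  exact ((hG.differentiable (by simp)) (x, s)).hasFDerivAt.comp_hasDerivAt s h1

lemma joint_dx (G : E × ℝ → F) (hG : ContDiff ℝ (⊤ : ℕ∞) G) (x : E) (s : ℝ) :
    HasFDerivAt (fun y => G (y, s)) ((fderiv ℝ G (x, s)).comp (ContinuousLinearMap.inl ℝ E ℝ)) x := by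
  have h1 : HasFDerivAt (fun y : E => ((y, s) : E × ℝ)) (ContinuousLinearMap.inl ℝ E ℝ) x :=
    hasFDerivAt_prodMk_left x s
  exact ((hG.differentiable (by simp)) (x, s)).hasFDerivAt.comp x h1

lemma joint_smooth_dt (G : E × ℝ → F) (hG : ContDiff ℝ (⊤ : ℕ∞) G) :
    ContDiff ℝ (⊤ : ℕ∞) (fun z => fderiv ℝ G z (0, 1)) :=
  (hG.fderiv_right (m := ((⊤ : ℕ∞) : WithTop ℕ∞)) (by simp)).clm_apply contDiff_const

lemma joint_smooth_dx (G : E × ℝ → F) (hG : ContDiff ℝ (⊤ : ℕ∞) G) :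
    ContDiff ℝ (⊤ : ℕ∞) (fun z => (fderiv ℝ G z).comp (ContinuousLinearMap.inl ℝ E ℝ)) :=
  (hG.fderiv_right (m := ((⊤ : ℕ∞) : WithTop ℕ∞)) (by simp)).clm_comp contDiff_const

lemma iter_eq (G : E × ℝ → ℝ) (p : ℕ) (x : E) (s : ℝ)
    (hp : ContDiff ℝ (⊤ : ℕ∞) (fun z : E × ℝ => iteratedFDeriv ℝ p (fun y => G (y, z.2)) z.1)) :
    iteratedFDeriv ℝ (p + 1) (fun y => G (y, s)) x =
      (continuousMultilinearCurryLeftEquiv ℝ (fun _ : Fin (p + 1) => E) ℝ).symm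
        ((fderiv ℝ (fun z : E × ℝ => iteratedFDeriv ℝ p (fun y => G (y, z.2)) z.1) (x, s)).comp
          (ContinuousLinearMap.inl ℝ E ℝ)) := by
  rw [← (joint_dx _ hp x s).fderiv]
  exact congrFun (iteratedFDeriv_succ_eq_comp_left (f := fun y => G (y, s)) (n := p)) _

lemma iter_smooth (G : E × ℝ → ℝ) (hG : ContDiff ℝ (⊤ : ℕ∞) G) (p : ℕ) :
    ContDiff ℝ (⊤ : ℕ∞) (fun z : E × ℝ => iteratedFDeriv ℝ p (fun y => G (y, z.2)) z.1) := by
  induction p with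
  | zero =>
    exact (continuousMultilinearCurryFin0 ℝ E ℝ).symm.toContinuousLinearEquiv.contDiff.comp hG
  | succ p ih =>
    have : (fun z : E × ℝ => iteratedFDeriv ℝ (p + 1) (fun y => G (y, z.2)) z.1) = fun z =>
      (continuousMultilinearCurryLeftEquiv ℝ (fun _ : Fin (p + 1) => E) ℝ).symm
        ((fderiv ℝ (fun z : E × ℝ => iteratedFDeriv ℝ p (fun y => G (y, z.2)) z.1) z).comp
          (ContinuousLinearMap.inl ℝ E ℝ)) := by
      funext z
      exact iter_eq G p z.1 z.2 ih
    rw [this]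
    exact (continuousMultilinearCurryLeftEquiv ℝ
      (fun _ : Fin (p + 1) => E) ℝ).symm.toContinuousLinearEquiv.contDiff.comp
        (joint_smooth_dx _ ih)

/-- Time and space derivatives commute. -/
lemma dt_dx_comm (G : E × ℝ → F) (hG : ContDiff ℝ (⊤ : ℕ∞) G) (z : E × ℝ) :
    fderiv ℝ (fun z => (fderiv ℝ G z).comp (ContinuousLinearMap.inl ℝ E ℝ)) z (0, 1) =
      (fderiv ℝ (fun z => fderiv ℝ G z (0, 1)) z).comp (ContinuousLinearMap.inl ℝ E ℝ) := by
  have hG1 : ContDiff ℝ (⊤ : ℕ∞) (fderiv ℝ G) :=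
    hG.fderiv_right (m := ((⊤ : ℕ∞) : WithTop ℕ∞)) (by simp)
  have hd : HasFDerivAt (fderiv ℝ G) (fderiv ℝ (fderiv ℝ G) z) z :=
    ((hG1.differentiable (by simp)) z).hasFDerivAt
  have hs : IsSymmSndFDerivAt ℝ G z := (hG.contDiffAt).isSymmSndFDerivAt (by
    rw [minSmoothness_of_isRCLikeNormedField]; exact WithTop.coe_le_coe.2 (le_top : (2 : ℕ∞) ≤ ⊤))
  have h1 := hd.clm_comp (hasFDerivAt_const (ContinuousLinearMap.inl ℝ E ℝ) z)
  have h2 := hd.clm_apply (hasFDerivAt_const ((0, 1) : E × ℝ) z)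
  rw [h1.fderiv, h2.fderiv]
  ext v
  simp
  exact hs _ _

lemma iter_dt (G : E × ℝ → ℝ) (hG : ContDiff ℝ (⊤ : ℕ∞) G) (p : ℕ) :
    (fun z : E × ℝ => fderiv ℝ (fun z : E × ℝ => iteratedFDeriv ℝ p (fun y => G (y, z.2)) z.1) z (0, 1))
      = fun z => iteratedFDeriv ℝ p (fun y => fderiv ℝ G (y, z.2) (0, 1)) z.1 := by
  induction p with
  | zero =>
    funext z
    have : (fun z : E × ℝ => iteratedFDeriv ℝ 0 (fun y => G (y, z.2)) z.1) =
      (continuousMultilinearCurryFin0 ℝ E ℝ).symm.toContinuousLinearEquiv ∘ G := rfl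
    rw [this, ContinuousLinearEquiv.comp_fderiv]
    rfl
  | succ p ih =>
    funext z
    have hp := iter_smooth G hG p
    have e1 : (fun z : E × ℝ => iteratedFDeriv ℝ (p + 1) (fun y => G (y, z.2)) z.1) =
      (continuousMultilinearCurryLeftEquiv ℝ
        (fun _ : Fin (p + 1) => E) ℝ).symm.toContinuousLinearEquiv ∘ fun z =>
        ((fderiv ℝ (fun z : E × ℝ => iteratedFDeriv ℝ p (fun y => G (y, z.2)) z.1) z).comp
          (ContinuousLinearMap.inl ℝ E ℝ)) := by
      funext z
      exact iter_eq G p z.1 z.2 hp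
    have hL := ((continuousMultilinearCurryLeftEquiv ℝ (fun _ : Fin (p + 1) => E)
      ℝ).symm.toContinuousLinearEquiv.toContinuousLinearMap).hasFDerivAt.comp z
        (((joint_smooth_dx _ hp).differentiable (by simp)) z).hasFDerivAt
    have hL' := hL.congr_of_eventuallyEq
      (f₁ := fun z : E × ℝ => iteratedFDeriv ℝ (p + 1) (fun y => G (y, z.2)) z.1)
      (Filter.Eventually.of_forall fun z => congrFun e1 z)
    rw [hL'.fderiv]
    rw [iter_eq (fun w => fderiv ℝ G w (0, 1)) p z.1 z.2 (iter_smooth _ (joint_smooth_dt G hG) p)]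
    rw [← ih, ← dt_dx_comm _ hp]
    rfl

lemma timeDeriv_smooth (u : E × ℝ → ℝ) (hu : ContDiff ℝ (⊤ : ℕ∞) u) (q : ℕ) :
    ContDiff ℝ (⊤ : ℕ∞) (fun z : E × ℝ => iteratedDeriv q (fun τ => u (z.1, τ)) z.2) ∧
    ∀ y s, iteratedDeriv (q + 1) (fun τ => u (y, τ)) s =
      fderiv ℝ (fun z : E × ℝ => iteratedDeriv q (fun τ => u (z.1, τ)) z.2) (y, s) (0, 1) := by
  have key : ∀ q, ContDiff ℝ (⊤ : ℕ∞) (fun z : E × ℝ => iteratedDeriv q (fun τ => u (z.1, τ)) z.2) →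
    ∀ y s, iteratedDeriv (q + 1) (fun τ => u (y, τ)) s =
      fderiv ℝ (fun z : E × ℝ => iteratedDeriv q (fun τ => u (z.1, τ)) z.2) (y, s) (0, 1) := by
    intro q hq y s
    rw [iteratedDeriv_succ]
    exact (joint_dt _ hq y s).deriv
  suffices h : ContDiff ℝ (⊤ : ℕ∞) (fun z : E × ℝ => iteratedDeriv q (fun τ => u (z.1, τ)) z.2) from
    ⟨h, key q h⟩
  induction q with
  | zero => simpa using hu
  | succ q ih =>
    have : (fun z : E × ℝ => iteratedDeriv (q + 1) (fun τ => u (z.1, τ)) z.2) = fun z =>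
        fderiv ℝ (fun z : E × ℝ => iteratedDeriv q (fun τ => u (z.1, τ)) z.2) z (0, 1) := by
      funext z
      exact key q ih z.1 z.2
    rw [this]
    exact joint_smooth_dt _ ih

end Joint

lemma std_hasDerivAt (d : ℕ) (u : EuclideanSpace ℝ (Fin d) × ℝ → ℝ)
    (hu : ContDiff ℝ (⊤ : ℕ∞) u) (p q : ℕ) (x : EuclideanSpace ℝ (Fin d)) (s : ℝ) :
    HasDerivAt (fun s => spaceTimeDeriv d u p q x s) (spaceTimeDeriv d u p (q + 1) x s) s := by
  obtain ⟨hs, he⟩ := timeDeriv_smooth u hu q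
  have h := joint_dt _ (iter_smooth _ hs p) x s
  have h2 := congrFun (iter_dt _ hs p) (x, s)
  simp only at h2 h
  rw [h2] at h
  unfold spaceTimeDeriv
  simp_rw [he]
  exact h

lemma std_smooth (d : ℕ) (u : EuclideanSpace ℝ (Fin d) × ℝ → ℝ)
    (hu : ContDiff ℝ (⊤ : ℕ∞) u) (q : ℕ) (s : ℝ) :
    ContDiff ℝ (⊤ : ℕ∞) (fun y => iteratedDeriv q (fun τ => u (y, τ)) s) :=
  (timeDeriv_smooth u hu q).1.comp (contDiff_id.prodMk contDiff_const)

lemma pdist_space (d : ℕ) (x y : EuclideanSpace ℝ (Fin d)) (s : ℝ) :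
    parabolicDist d (x, s) (y, s) = ‖x - y‖ := by
  simp [parabolicDist]

lemma pdist_time (d : ℕ) (x : EuclideanSpace ℝ (Fin d)) (s s' r : ℝ) (hr : 0 ≤ r)
    (h : |s - s'| ≤ r ^ 2 / 2) : parabolicDist d (x, s) (x, s') ≤ r := by
  simp only [parabolicDist, sub_self, norm_zero, zero_add]
  rw [← Real.sqrt_eq_rpow]
  rw [Real.sqrt_le_left hr]
  nlinarith [sq_nonneg r]

/-- The time-first path, for even top order. -/
lemma path_one (d n p q : ℕ) (hpq : p + 2 * q ≤ 2 * n) (δ : ℝ) (hδ : 0 < δ) (hδ1 : δ ≤ 1) :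
    ∃ C : ℝ, 0 ≤ C ∧ ∀ (u : EuclideanSpace ℝ (Fin d) × ℝ → ℝ) (_ : ContDiff ℝ (⊤ : ℕ∞) u)
      (ρ ρ' t r A H : ℝ) (_ : ρ' + p * δ ≤ ρ) (_ : 0 < r) (_ : r ≤ 1) (_ : 0 ≤ A) (_ : 0 ≤ H)
      (_ : ∀ z ∈ parabolicCylinder d ρ t, |u z| ≤ A)
      (_ : ∀ i ≤ n, ∀ z ∈ parabolicCylinder d ρ t, ∀ w ∈ parabolicCylinder d ρ t,
        parabolicDist d z w ≤ r → ‖spaceTimeDeriv d u (2 * n - 2 * i) i z.1 z.2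
          - spaceTimeDeriv d u (2 * n - 2 * i) i w.1 w.2‖ ≤ H),
      ∀ z ∈ parabolicCylinder d ρ' t,
        ‖spaceTimeDeriv d u p q z.1 z.2‖ ≤ C * (A + r ^ (2 * n) * H) / r ^ (p + 2 * q) := by
  obtain ⟨C1, hC1, ht⟩ := time_interp n q (by omega)
  obtain ⟨C2, hC2, hs⟩ := space_interp (2 * n - 2 * q) p (by omega)
  refine ⟨C2 * (C1 * 2 ^ q + 1) / δ ^ p, by positivity, ?_⟩
  intro u hu ρ ρ' t r A H hρ hr hr1 hA0 hH0 hA hH z hz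
  obtain ⟨hz1, hz2, hz3⟩ := hz
  set K := A + r ^ (2 * n) * H with hK
  have hK0 : 0 ≤ K := by positivity
  have hδr : δ * r ≤ r := by nlinarith
  have hpδr : (p : ℝ) * (δ * r) ≤ p * δ := by
    have : δ * r ≤ δ := by nlinarith
    gcongr
  have h1 : ∀ x : EuclideanSpace ℝ (Fin d), ‖x‖ ≤ ρ → ∀ s, t - 1 ≤ s → s ≤ t →
      ‖spaceTimeDeriv d u 0 q x s‖ ≤ C1 * 2 ^ q * K / r ^ (2 * q) := by
    intro x hx s hs1 hs2
    have := ht _ (fun i s => spaceTimeDeriv d u 0 i x s)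
      (fun i s => std_hasDerivAt d u hu 0 i x s) t (r ^ 2 / 2) A H (by positivity)
      (by nlinarith) hA0 hH0 (fun s hs1 hs2 => by
        have := hA (x, s) ⟨hx, hs1, hs2⟩
        simpa [spaceTimeDeriv] using this) (fun s s' a b a' b' hss => by
        have := hH n le_rfl (x, s) ⟨hx, a, b⟩ (x, s') ⟨hx, a', b'⟩
          (pdist_time d x s s' r hr.le hss)
        rw [Nat.sub_self] at this
        exact this) s hs1 hs2
    refine this.trans ?_
    have e : (r ^ 2 / 2) ^ n * H ≤ r ^ (2 * n) * H := by
      rw [pow_mul]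
      gcongr
      nlinarith [sq_nonneg r]
    calc C1 * (A + (r ^ 2 / 2) ^ n * H) / (r ^ 2 / 2) ^ q ≤ C1 * K / (r ^ 2 / 2) ^ q := by
          gcongr
          linarith
      _ = _ := by
          rw [div_pow, ← pow_mul]
          field_simp
  have h2 := hs _ (fun y => iteratedDeriv q (fun τ => u (y, τ)) z.2) (std_smooth d u hu q z.2)
    ρ (δ * r) (C1 * 2 ^ q * K / r ^ (2 * q)) H (by positivity) (by positivity) hH0
    (fun x hx => by
      have := h1 x hx z.2 hz2 hz3
      simpa [spaceTimeDeriv] using this) (fun x y hx hy hxy =>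
        hH q (by omega) (x, z.2) ⟨hx, hz2, hz3⟩ (y, z.2) ⟨hy, hz2, hz3⟩
          (by rw [pdist_space]; linarith)) z.1 (by linarith)
  refine h2.trans ?_
  have e : (δ * r) ^ (2 * n - 2 * q) * H ≤ K / r ^ (2 * q) := by
    rw [le_div_iff₀ (by positivity)]
    calc (δ * r) ^ (2 * n - 2 * q) * H * r ^ (2 * q)
        ≤ r ^ (2 * n - 2 * q) * H * r ^ (2 * q) := by gcongr
      _ = r ^ (2 * n) * H := by
          rw [mul_right_comm, ← pow_add]; congr 2; omega
      _ ≤ K := by linarith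
  calc _ ≤ C2 * (C1 * 2 ^ q * K / r ^ (2 * q) + K / r ^ (2 * q)) / (δ * r) ^ p := by gcongr
    _ = _ := by
      rw [mul_pow, pow_add]
      field_simp

/-- The space-first path, for derivatives of top order. -/
lemma path_two (d m q : ℕ) (hq : 2 * q ≤ m) (δ : ℝ) (hδ : 0 < δ) (hδ1 : δ ≤ 1) :
    ∃ C : ℝ, 0 ≤ C ∧ ∀ (u : EuclideanSpace ℝ (Fin d) × ℝ → ℝ) (_ : ContDiff ℝ (⊤ : ℕ∞) u)
      (ρ ρ' t r A H : ℝ) (_ : ρ' + m * δ ≤ ρ) (_ : 0 < r) (_ : r ≤ 1) (_ : 0 ≤ A) (_ : 0 ≤ H)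
      (_ : ∀ z ∈ parabolicCylinder d ρ t, |u z| ≤ A)
      (_ : ∀ i, 2 * i ≤ m → ∀ z ∈ parabolicCylinder d ρ t, ∀ w ∈ parabolicCylinder d ρ t,
        parabolicDist d z w ≤ r → ‖spaceTimeDeriv d u (m - 2 * i) i z.1 z.2
          - spaceTimeDeriv d u (m - 2 * i) i w.1 w.2‖ ≤ H),
      ∀ z ∈ parabolicCylinder d ρ' t,
        ‖spaceTimeDeriv d u (m - 2 * q) q z.1 z.2‖ ≤ C * (A + r ^ m * H) / r ^ m := by
  obtain ⟨C1, hC1, ht⟩ := time_interp q q le_rfl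
  obtain ⟨C2, hC2, hs⟩ := space_interp m (m - 2 * q) (by omega)
  refine ⟨C1 * (C2 / δ ^ (m - 2 * q) + 1) * 2 ^ q, by positivity, ?_⟩
  intro u hu ρ ρ' t r A H hρ hr hr1 hA0 hH0 hA hH z hz
  obtain ⟨hz1, hz2, hz3⟩ := hz
  set K := A + r ^ m * H with hK
  have hK0 : 0 ≤ K := by positivity
  have hδr : δ * r ≤ r := by nlinarith
  have hδr' : δ * r ≤ δ := by nlinarith
  have hmδ : 0 ≤ (m : ℝ) * δ := by positivity
  set p := m - 2 * q with hp
  have hpm : p ≤ m := by omega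
  have hpδr : (p : ℝ) * (δ * r) ≤ m * δ := by
    gcongr
  have h1 : ∀ s, t - 1 ≤ s → s ≤ t →
      ‖spaceTimeDeriv d u p 0 z.1 s‖ ≤ C2 / δ ^ p * K / r ^ p := by
    intro s hs1 hs2
    have h2 := hs _ (fun y => iteratedDeriv 0 (fun τ => u (y, τ)) s) (std_smooth d u hu 0 s)
      ρ (δ * r) A H (by positivity) hA0 hH0
      (fun x hx => by
        have := hA (x, s) ⟨hx, hs1, hs2⟩
        simpa using this) (fun x y hx hy hxy =>
          hH 0 (by omega) (x, s) ⟨hx, hs1, hs2⟩ (y, s) ⟨hy, hs1, hs2⟩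
            (by rw [pdist_space]; linarith)) z.1 (by linarith)
    refine h2.trans ?_
    have e : (δ * r) ^ m * H ≤ r ^ m * H := by gcongr
    calc _ ≤ C2 * K / (δ * r) ^ p := by gcongr; linarith
      _ = _ := by
        rw [mul_pow]
        field_simp
  have hz1' : ‖z.1‖ ≤ ρ := by linarith
  have h3 := ht _ (fun i s => spaceTimeDeriv d u p i z.1 s)
      (fun i s => std_hasDerivAt d u hu p i z.1 s) t (r ^ 2 / 2) (C2 / δ ^ p * K / r ^ p) H
      (by positivity) (by nlinarith) (by positivity) hH0 h1 (fun s s' a b a' b' hss =>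
        hH q hq (z.1, s) ⟨hz1', a, b⟩ (z.1, s') ⟨hz1', a', b'⟩
          (pdist_time d z.1 s s' r hr.le hss)) z.2 hz2 hz3
  refine h3.trans ?_
  have epow : r ^ m = r ^ p * r ^ (2 * q) := by
    rw [← pow_add]; congr 1; omega
  have e : (r ^ 2 / 2) ^ q * H ≤ K / r ^ p := by
    rw [le_div_iff₀ (by positivity)]
    calc (r ^ 2 / 2) ^ q * H * r ^ p ≤ (r ^ 2) ^ q * H * r ^ p := by
          gcongr
          nlinarith [sq_nonneg r]
      _ = r ^ m * H := by rw [epow, pow_mul]; ring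
      _ ≤ K := by linarith
  calc _ ≤ C1 * (C2 / δ ^ p * K / r ^ p + K / r ^ p) / (r ^ 2 / 2) ^ q := by gcongr
    _ = _ := by
      rw [epow, div_pow, ← pow_mul]
      field_simp

/-- Unpack a Hölder bound at scale `r`. -/
lemma holder_unpack (d : ℕ) (u : EuclideanSpace ℝ (Fin d) × ℝ → ℝ) (m : ℕ) (α : ℝ) (hα : 0 < α)
    (Q : Set (EuclideanSpace ℝ (Fin d) × ℝ)) (B : ℝ) (h : frakDHolderLE d u m α Q B)
    (r : ℝ) (i : ℕ) (hi : 2 * i ≤ m) (z) (hz : z ∈ Q) (w) (hw : w ∈ Q)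
    (hzw : parabolicDist d z w ≤ r) :
    ‖spaceTimeDeriv d u (m - 2 * i) i z.1 z.2
          - spaceTimeDeriv d u (m - 2 * i) i w.1 w.2‖ ≤ B * r ^ α := by
  obtain ⟨M, hM0, hM, hh⟩ := h
  have hmem : i ∈ Finset.range (m / 2 + 1) := Finset.mem_range.2 (by omega)
  have h1 := hh i hmem z hz w hw
  have h2 : M i ≤ B := (Finset.single_le_sum (fun j _ => hM0 j) hmem).trans hM
  have hd0 : 0 ≤ parabolicDist d z w := by unfold parabolicDist; positivity
  have h3 : parabolicDist d z w ^ α ≤ r ^ α := Real.rpow_le_rpow hd0 hzw hα.le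
  have := hM0 i
  have : 0 ≤ parabolicDist d z w ^ α := by positivity
  have : 0 ≤ r ^ α := by linarith
  exact h1.trans (mul_le_mul h2 h3 (by positivity) (by linarith [hM0 i]))

/-- The choice of scale. -/
lemma scale_choice (C₀ t α b c : ℝ) (m l : ℕ) (hα : 0 < α) (hm : 1 ≤ m) (ht : 1 ≤ t)
    (hb : -2 ≤ b) : ∃ r : ℝ, 0 < r ∧ r ≤ 1 ∧
      c * (C₀ * Real.exp (-2 * t) + r ^ m * (C₀ * Real.exp (b * t) * r ^ α)) / r ^ l =
        2 * c * C₀ * Real.exp (-(t / 2) * (4 - 2 * (l * (2 + b)) / (m + α))) := by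
  have hm' : (0 : ℝ) < m + α := by positivity
  refine ⟨Real.exp (-((2 + b) * t / (m + α))), Real.exp_pos _, ?_, ?_⟩
  · rw [Real.exp_le_one_iff]
    have : 0 ≤ (2 + b) * t / (m + α) := by
      apply div_nonneg _ hm'.le
      nlinarith
    linarith
  · rw [← Real.exp_mul, ← Real.exp_nat_mul, ← Real.exp_nat_mul]
    have e1 : Real.exp (m * -((2 + b) * t / (m + α))) * (C₀ * Real.exp (b * t) *
        Real.exp (-((2 + b) * t / (m + α)) * α)) = C₀ * Real.exp (-2 * t) := by
      rw [mul_left_comm, mul_assoc, mul_left_comm, ← Real.exp_add, mul_left_comm, ← Real.exp_add]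
      congr 2
      field_simp
      ring
    rw [e1, div_eq_mul_inv, ← Real.exp_neg]
    have e2 : Real.exp (-(t / 2) * (4 - 2 * (l * (2 + b)) / (m + α))) =
        Real.exp (-2 * t) * Real.exp (-(l * -((2 + b) * t / (m + α)))) := by
      rw [← Real.exp_add]
      congr 1
      field_simp
      ring
    rw [e2]
    ring

lemma frakD_le (d : ℕ) (u : EuclideanSpace ℝ (Fin d) × ℝ → ℝ) (k : ℕ)
    (z : EuclideanSpace ℝ (Fin d) × ℝ) (c : ℕ → ℝ) (X : ℝ)
    (h : ∀ q ∈ Finset.range (k / 2 + 1), ‖spaceTimeDeriv d u (k - 2 * q) q z.1 z.2‖ ≤ c q * X) :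
    frakDNorm d u k z ≤ (∑ q ∈ Finset.range (k / 2 + 1), c q) * X := by
  unfold frakDNorm
  rw [Finset.sum_mul]
  refine le_trans ?_ (Finset.sum_le_sum h)
  refine Real.sqrt_le_iff.2 ⟨by positivity, ?_⟩
  exact Finset.sum_sq_le_sq_sum_of_nonneg (fun _ _ => norm_nonneg _)

end Helpers

/-- Higher-order interpolation estimate (estimate (5.10), part of Lemma 5.6 of the
paper, in conditional form). -/
theorem higher_order_interp_estimate
    (d : ℕ) (hd : 1 ≤ d) (ρ ρ' : ℝ) (hρ' : 0 < ρ') (hρ : ρ' < ρ)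
    (α : ℝ) (hα0 : 0 < α) (hα1 : α < 1) (k : ℕ) (hk : 10 ≤ k) (C₀ : ℝ) (hC₀ : 0 < C₀)
    (u : EuclideanSpace ℝ (Fin d) × ℝ → ℝ) (hu : ContDiff ℝ (⊤ : ℕ∞) u)
    (h1 : ∀ t ≥ (1 : ℝ), ∀ z ∈ parabolicCylinder d ρ t, |u z| ≤ C₀ * Real.exp (-2 * t))
    (h2 : ∀ t ≥ (1 : ℝ), frakDHolderLE d u 8 α (parabolicCylinder d ρ t) (C₀ * Real.exp (-t)))
    (h3 : ∀ t ≥ (1 : ℝ), ∀ ℓ : ℕ, 8 ≤ ℓ → ℓ ≤ 2 * k + 10 →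
      frakDHolderLE d u ℓ α (parabolicCylinder d ρ t)
        (C₀ * Real.exp (((ℓ : ℝ) - 10) * t / 2))) :
    ∃ C > 0, ∀ t ≥ (1 : ℝ),
      (∀ ℓ : ℕ, ℓ ≤ 8 → ∀ z ∈ parabolicCylinder d ρ' t,
        frakDNorm d u ℓ z ≤ C * Real.exp (-(t / 2) * (4 - 2 * (ℓ : ℝ) / (8 + α)))) ∧
      (∀ ℓ : ℕ, 8 ≤ ℓ → ℓ ≤ 2 * k + 10 → ∀ z ∈ parabolicCylinder d ρ' t,
        frakDNorm d u ℓ z ≤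
          C * Real.exp (-(t / 2) * (4 - (ℓ : ℝ) * ((ℓ : ℝ) - 6) / ((ℓ : ℝ) + α)))) := by
  have hC0' := hC₀.le
  obtain ⟨δ, hδ, hδ1, hδρ⟩ : ∃ δ : ℝ, 0 < δ ∧ δ ≤ 1 ∧ ρ' + ((2 * k + 10 : ℕ) : ℝ) * δ ≤ ρ := by
    have hn : (0 : ℝ) < ((2 * k + 10 : ℕ) : ℝ) := by positivity
    refine ⟨min 1 ((ρ - ρ') / ((2 * k + 10 : ℕ) : ℝ)), lt_min one_pos (div_pos (by linarith) hn),
      min_le_left _ _, ?_⟩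
    have := min_le_right 1 ((ρ - ρ') / ((2 * k + 10 : ℕ) : ℝ))
    rw [le_div_iff₀ hn] at this
    linarith
  have hδm : ∀ m : ℕ, m ≤ 2 * k + 10 → ρ' + (m : ℝ) * δ ≤ ρ := by
    intro m hm
    have : (m : ℝ) * δ ≤ ((2 * k + 10 : ℕ) : ℝ) * δ := by gcongr
    linarith
  have P1 : ∀ ℓ q : ℕ, ∃ C : ℝ, 0 ≤ C ∧ (ℓ ≤ 8 → 2 * q ≤ ℓ → ∀ t ≥ (1 : ℝ),
      ∀ z ∈ parabolicCylinder d ρ' t, ‖spaceTimeDeriv d u (ℓ - 2 * q) q z.1 z.2‖ ≤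
        C * Real.exp (-(t / 2) * (4 - 2 * (ℓ : ℝ) / (8 + α)))) := by
    intro ℓ q
    by_cases hl : ℓ ≤ 8 ∧ 2 * q ≤ ℓ
    swap
    · exact ⟨0, le_rfl, fun a b => absurd ⟨a, b⟩ hl⟩
    obtain ⟨hl, hq⟩ := hl
    obtain ⟨c, hc, hP⟩ := path_one d 4 (ℓ - 2 * q) q (by omega) δ hδ hδ1
    refine ⟨2 * c * C₀, by positivity, fun _ _ t ht z hz => ?_⟩
    obtain ⟨r, hr, hr1, he⟩ := scale_choice C₀ t α (-1) c 8 ℓ hα0 (by omega) ht (by norm_num)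
    have := hP u hu ρ ρ' t r (C₀ * Real.exp (-2 * t)) (C₀ * Real.exp (-1 * t) * r ^ α)
      (hδm _ (by omega)) hr hr1 (by positivity) (by positivity) (h1 t ht)
      (fun i hi z hz w hw hzw => holder_unpack d u 8 α hα0 _ _ (by
        have := h2 t ht
        rwa [← neg_one_mul t] at this) r i (by omega) z hz w hw hzw) z hz
    have e : ℓ - 2 * q + 2 * q = ℓ := by omega
    rw [e] at this
    refine this.trans (le_of_eq ?_)
    rw [show 2 * 4 = 8 from rfl, he]
    norm_num
  have P2 : ∀ ℓ q : ℕ, ∃ C : ℝ, 0 ≤ C ∧ (8 ≤ ℓ → ℓ ≤ 2 * k + 10 → 2 * q ≤ ℓ → ∀ t ≥ (1 : ℝ),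
      ∀ z ∈ parabolicCylinder d ρ' t, ‖spaceTimeDeriv d u (ℓ - 2 * q) q z.1 z.2‖ ≤
        C * Real.exp (-(t / 2) * (4 - (ℓ : ℝ) * ((ℓ : ℝ) - 6) / ((ℓ : ℝ) + α)))) := by
    intro ℓ q
    by_cases hl : 8 ≤ ℓ ∧ ℓ ≤ 2 * k + 10 ∧ 2 * q ≤ ℓ
    swap
    · exact ⟨0, le_rfl, fun a b c => absurd ⟨a, b, c⟩ hl⟩
    obtain ⟨hl8, hl, hq⟩ := hl
    obtain ⟨c, hc, hP⟩ := path_two d ℓ q hq δ hδ hδ1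
    refine ⟨2 * c * C₀, by positivity, fun _ _ _ t ht z hz => ?_⟩
    have hl8' : (8 : ℝ) ≤ ℓ := by exact_mod_cast hl8
    obtain ⟨r, hr, hr1, he⟩ := scale_choice C₀ t α (((ℓ : ℝ) - 10) / 2) c ℓ ℓ hα0 (by omega) ht
      (by linarith)
    have := hP u hu ρ ρ' t r (C₀ * Real.exp (-2 * t))
      (C₀ * Real.exp (((ℓ : ℝ) - 10) / 2 * t) * r ^ α)
      (hδm _ hl) hr hr1 (by positivity) (by positivity) (h1 t ht)
      (fun i hi z hz w hw hzw => holder_unpack d u ℓ α hα0 _ _ (by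
        have := h3 t ht ℓ hl8 hl
        rwa [mul_div_right_comm] at this) r i hi z hz w hw hzw) z hz
    refine this.trans (le_of_eq ?_)
    rw [he]
    congr 5
    ring
  choose c1 hc1 P1 using P1
  choose c2 hc2 P2 using P2
  set S1 : ℕ → ℝ := fun ℓ => ∑ q ∈ Finset.range (ℓ / 2 + 1), c1 ℓ q with hS1
  set S2 : ℕ → ℝ := fun ℓ => ∑ q ∈ Finset.range (ℓ / 2 + 1), c2 ℓ q with hS2
  have hS10 : ∀ ℓ, 0 ≤ S1 ℓ := fun ℓ => Finset.sum_nonneg fun q _ => hc1 ℓ q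
  have hS20 : ∀ ℓ, 0 ≤ S2 ℓ := fun ℓ => Finset.sum_nonneg fun q _ => hc2 ℓ q
  have hle : ∀ ℓ, ℓ ≤ 2 * k + 10 →
      S1 ℓ + S2 ℓ ≤ ∑ j ∈ Finset.range (2 * k + 11), (S1 j + S2 j) := fun ℓ hℓ =>
    Finset.single_le_sum (f := fun j => S1 j + S2 j)
      (fun j _ => add_nonneg (hS10 j) (hS20 j)) (Finset.mem_range.2 (by omega))
  have hsum0 : 0 ≤ ∑ j ∈ Finset.range (2 * k + 11), (S1 j + S2 j) :=
    Finset.sum_nonneg fun j _ => add_nonneg (hS10 j) (hS20 j)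
  refine ⟨∑ j ∈ Finset.range (2 * k + 11), (S1 j + S2 j) + 1, by linarith, fun t ht => ⟨?_, ?_⟩⟩
  · intro ℓ hℓ z hz
    refine (frakD_le d u ℓ z (c1 ℓ) _ fun q hq => P1 ℓ q hℓ
      (by have := Finset.mem_range.1 hq; omega) t ht z hz).trans ?_
    refine mul_le_mul_of_nonneg_right ?_ (Real.exp_pos _).le
    have := hle ℓ (by omega)
    have := hS20 ℓ
    change S1 ℓ ≤ _
    linarith
  · intro ℓ hℓ8 hℓ z hz
    refine (frakD_le d u ℓ z (c2 ℓ) _ fun q hq => P2 ℓ q hℓ8 hℓ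
      (by have := Finset.mem_range.1 hq; omega) t ht z hz).trans ?_
    refine mul_le_mul_of_nonneg_right ?_ (Real.exp_pos _).le
    have := hle ℓ hℓ
    have := hS10 ℓ
    change S2 ℓ ≤ _
    linarith
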